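/- Let 𝒪 ∈ SO(3) and let α : ℤ × ℝ → ℂ be a solution of the Ablowitz–Ladik system (each t ↦ α_n(t) differentiable and satisfying the equation for all n and t). Define Q_n(t) = Q(α_n(t)); let A_n(t) be the antisymmetric matrix [[0, −2Re(conj(α_n)α_{n−1}), −2Im(α_n−α_{n−1})], [2Re(conj(α_n)α_{n−1}), 0, −2Re(α_n−α_{n−1})], [2Im(α_n−α_{n−1}), 2Re(α_n−α_{n−1}), 0]]; let P₀ : ℝ → M₃(ℝ) be differentiable with (d/dt)P₀ = P₀A₀ and P₀(0) = 𝒪; and define P_n for all n ∈ ℤ by P_{n+1}(t) = P_n(t)Q_n(t). Then S_n(t) := P_n(t)e₃ lies in 𝕊² for every n and t, satisfies 1 + S_n(t)·S_{n+1}(t) = 2/(1+|α_n(t)|²) > 0, and S is a global solution of the lattice Heisenberg model: (d/dt)S_n = −S_n × ( 2S_{n+1}/(1+S_n·S_{n+1}) + 2S_{n−1}/(1+S_n·S_{n−1}) ) for all n ∈ ℤ and t ∈ ℝ. -/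

import Mathlib

open Matrix
noncomputable section

/-- 3×3 real matrices. -/
abbrev Mat3 := Matrix (Fin 3) (Fin 3) ℝ

/-- Membership in SO(3): orthogonal with determinant 1. -/
def IsSO3 (M : Mat3) : Prop := M * Mᵀ = 1 ∧ M.det = 1

/-- The vector e₃ = (0,0,1). -/
def e3 : Fin 3 → ℝ := ![0, 0, 1]

/-- The matrix Q(z) = (1/(1+|z|²)) [[1−Re z², Im z², 2Re z], [Im z², 1+Re z², −2Im z],
[−2Re z, 2Im z, 1−|z|²]]. -/
def Qmat (z : ℂ) : Mat3 :=
  (1/(1 + Complex.normSq z)) •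
    !![1 - (z^2).re, (z^2).im, 2*z.re;
       (z^2).im, 1 + (z^2).re, -(2*z.im);
       -(2*z.re), 2*z.im, 1 - Complex.normSq z]

/-- `α : ℤ × ℝ → ℂ` is a (global) solution of the focusing Ablowitz–Ladik system:
each t ↦ α_n(t) is differentiable and i·(d/dt)α_n = −(1+|α_n|²)(α_{n+1}+α_{n−1}) + 2α_n. -/
def ALSolution (α : ℤ → ℝ → ℂ) : Prop :=
  ∀ (n : ℤ) (t : ℝ), ∃ d : ℂ,
    HasDerivAt (α n) d t ∧
    Complex.I * d
      = -(1 + (Complex.normSq (α n t) : ℂ)) * (α (n+1) t + α (n-1) t) + 2 * α n t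

/-- The antisymmetric matrix A_n built from a = α_n and b = α_{n−1}. -/
def Amat (a b : ℂ) : Mat3 :=
  !![0, -(2 * ((starRingEnd ℂ) a * b).re), -(2 * (a - b).im);
     2 * ((starRingEnd ℂ) a * b).re, 0, -(2 * (a - b).re);
     2 * (a - b).im, 2 * (a - b).re, 0]

/-- entrywise derivative -/
def MDer (M : ℝ → Mat3) (D : Mat3) (t : ℝ) : Prop :=
  ∀ i j : Fin 3, HasDerivAt (fun s : ℝ => M s i j) (D i j) t

lemma MDer.mul {M N : ℝ → Mat3} {M' N' : Mat3} {t : ℝ} (hM : MDer M M' t) (hN : MDer N N' t) :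
    MDer (fun s => M s * N s) (M' * N t + M t * N') t := by
  intro i j
  simp only [Matrix.mul_apply, Matrix.add_apply, Fin.sum_univ_three]
  have h := (((hM i 0).mul (hN 0 j)).add ((hM i 1).mul (hN 1 j))).add ((hM i 2).mul (hN 2 j))
  refine HasDerivAt.congr_deriv h ?_
  ring

lemma MDer.transpose {M : ℝ → Mat3} {M' : Mat3} {t : ℝ} (hM : MDer M M' t) :
    MDer (fun s => (M s)ᵀ) M'ᵀ t := fun i j => hM j i

lemma Amat_transpose (a b : ℂ) : (Amat a b)ᵀ = -Amat a b := by
  ext i j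
  fin_cases i <;> fin_cases j <;> simp [Amat]

lemma Q_orth (z : ℂ) : Qmat z * (Qmat z)ᵀ = 1 := by
  have h : (1 + (z.re * z.re + z.im * z.im)) ≠ 0 := by
    apply ne_of_gt
    nlinarith [mul_self_nonneg z.re, mul_self_nonneg z.im]
  ext i j
  fin_cases i <;> fin_cases j <;>
    simp [Qmat, Matrix.mul_apply, Fin.sum_univ_three, Complex.normSq_apply, pow_two] <;>
    field_simp <;> ring

lemma Q_det (z : ℂ) : (Qmat z).det = 1 := by
  have h : (1 + (z.re * z.re + z.im * z.im)) ≠ 0 := by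
    apply ne_of_gt
    nlinarith [mul_self_nonneg z.re, mul_self_nonneg z.im]
  rw [Matrix.det_fin_three]
  simp [Qmat, Complex.normSq_apply, pow_two]
  field_simp
  ring

lemma Q_der {a : ℝ → ℂ} {b c d : ℂ} {t : ℝ} (hd : HasDerivAt a d t)
    (h : Complex.I * d = -(1 + (Complex.normSq (a t) : ℂ)) * (c + b) + 2 * a t) :
    MDer (fun s => Qmat (a s)) (Qmat (a t) * Amat c (a t) - Amat (a t) b * Qmat (a t)) t := by
  have hx : HasDerivAt (fun s => (a s).re) d.re t :=
    (Complex.reCLM.hasFDerivAt.comp_hasDerivAt t hd)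
  have hy : HasDerivAt (fun s => (a s).im) d.im t :=
    (Complex.imCLM.hasFDerivAt.comp_hasDerivAt t hd)
  have h1 := congrArg Complex.re h
  have h2 := congrArg Complex.im h
  simp [Complex.normSq_apply] at h1 h2
  have e1 : d.im = (1 + ((a t).re * (a t).re + (a t).im * (a t).im)) * (c.re + b.re)
      - 2 * (a t).re := by linarith
  have e2 : d.re = -(1 + ((a t).re * (a t).re + (a t).im * (a t).im)) * (c.im + b.im)
      + 2 * (a t).im := by linarith
  rw [e1] at hy
  rw [e2] at hx
  have hD : (1 + ((a t).re * (a t).re + (a t).im * (a t).im)) ≠ 0 := by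
    apply ne_of_gt
    nlinarith [mul_self_nonneg (a t).re, mul_self_nonneg (a t).im]
  have hd1 := ((hasDerivAt_const t (1:ℝ)).add ((hx.mul hx).add (hy.mul hy))).inv hD
  have c1 := hasDerivAt_const t (1:ℝ)
  have c2 := hasDerivAt_const t (2:ℝ)
  have hxx := hx.mul hx
  have hyy := hy.mul hy
  have hxy := (hx.mul hy).add (hy.mul hx)
  intro i j
  fin_cases i <;> fin_cases j <;>
    simp [Qmat, Amat, Complex.normSq_apply, pow_two]
  · refine (hd1.mul (c1.sub (hxx.sub hyy))).congr_deriv ?_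
    simp
    field_simp
    ring
  · refine (hd1.mul hxy).congr_deriv ?_
    simp
    field_simp
    ring
  · refine (hd1.mul (c2.mul hx)).congr_deriv ?_
    simp
    field_simp
    ring
  · refine (hd1.mul hxy).congr_deriv ?_
    simp
    field_simp
    ring
  · refine (hd1.mul (c1.add (hxx.sub hyy))).congr_deriv ?_
    simp
    field_simp
    ring
  · refine (hd1.mul (c2.mul hy)).neg.congr_deriv ?_
    simp
    field_simp
    ring
  · refine (hd1.mul (c2.mul hx)).neg.congr_deriv ?_
    simp
    field_simp
    ring
  · refine (hd1.mul (c2.mul hy)).congr_deriv ?_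
    simp
    field_simp
    ring
  · refine (hd1.mul (c1.sub (hxx.add hyy))).congr_deriv ?_
    simp
    field_simp
    ring

lemma const_of_der {f : ℝ → ℝ} (h : ∀ t, HasDerivAt f 0 t) (t : ℝ) : f t = f 0 :=
  is_const_of_deriv_eq_zero (fun s => (h s).differentiableAt) (fun s => (h s).deriv) t 0

lemma det_der {M : ℝ → Mat3} {a b : ℂ} {t : ℝ} (h : MDer M (M t * Amat a b) t) :
    HasDerivAt (fun s => (M s).det) 0 t := by
  simp only [Matrix.det_fin_three]
  have h3 (i j k : Fin 3) := ((h 0 i).mul (h 1 j)).mul (h 2 k)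
  refine ((((((h3 0 1 2).sub (h3 0 2 1)).sub (h3 1 0 2)).add (h3 1 2 0)).add
    (h3 2 0 1)).sub (h3 2 1 0)).congr_deriv ?_
  simp [Amat, Matrix.mul_apply, Fin.sum_univ_three]
  ring

lemma mulVec_cross {M : Mat3} (h : M * Mᵀ = 1) (hd : M.det = 1) (v : Fin 3 → ℝ) :
    crossProduct (M *ᵥ e3) (M *ᵥ v) = M *ᵥ (crossProduct e3 v) := by
  have hadj : M.adjugate = Mᵀ := by
    have h1 : Mᵀ * M = 1 := mul_eq_one_comm.mp h
    calc M.adjugate = (Mᵀ * M) * M.adjugate := by rw [h1, one_mul]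
      _ = Mᵀ := by rw [mul_assoc, Matrix.mul_adjugate, hd, one_smul, mul_one]
  rw [Matrix.adjugate_fin_three] at hadj
  have k (i j : Fin 3) := congrFun (congrFun hadj i) j
  have k00 := k 0 0
  have k01 := k 0 1
  have k02 := k 0 2
  have k10 := k 1 0
  have k11 := k 1 1
  have k12 := k 1 2
  simp at k00 k01 k02 k10 k11 k12
  ext i
  fin_cases i <;>
    simp [e3, cross_apply, Matrix.mulVec, dotProduct, Fin.sum_univ_three]
  · linear_combination (v 1) * (-k00) - v 0 * (-k10)
  · linear_combination (v 1) * (-k01) - v 0 * (-k11)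
  · linear_combination (v 1) * (-k02) - v 0 * (-k12)

lemma dot_mulVec {M : Mat3} (h : M * Mᵀ = 1) (u v : Fin 3 → ℝ) :
    (M *ᵥ u) ⬝ᵥ (M *ᵥ v) = u ⬝ᵥ v := by
  have h1 : Mᵀ * M = 1 := mul_eq_one_comm.mp h
  rw [Matrix.dotProduct_mulVec, ← Matrix.mulVec_transpose, Matrix.mulVec_mulVec, h1,
    Matrix.one_mulVec]

/-- transferring a solution of Ablowitz–Ladik to a solution of the lattice
Heisenberg model via the parallel frames P_n: the spins S_n(t) = P_n(t)e₃ are unit vectors,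
satisfy 1 + S_n·S_{n+1} = 2/(1+|α_n|²) > 0, and solve the lattice Heisenberg model. -/
theorem AL_to_spin_solution
    (O : Mat3) (hO : IsSO3 O)
    (α : ℤ → ℝ → ℂ) (hα : ALSolution α)
    (P : ℤ → ℝ → Mat3)
    (hP0diff : ∀ (t : ℝ) (i j : Fin 3),
      HasDerivAt (fun s : ℝ => P 0 s i j) ((P 0 t * Amat (α 0 t) (α (-1) t)) i j) t)
    (hP00 : P 0 0 = O)
    (hPrec : ∀ (n : ℤ) (t : ℝ), P (n+1) t = P n t * Qmat (α n t)) :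
    ∀ (n : ℤ) (t : ℝ),
      ((P n t *ᵥ e3) ⬝ᵥ (P n t *ᵥ e3) = 1) ∧
      (1 + (P n t *ᵥ e3) ⬝ᵥ (P (n+1) t *ᵥ e3) = 2/(1 + Complex.normSq (α n t))) ∧
      (0 < 1 + (P n t *ᵥ e3) ⬝ᵥ (P (n+1) t *ᵥ e3)) ∧
      HasDerivAt (fun s : ℝ => P n s *ᵥ e3)
        (-(crossProduct (P n t *ᵥ e3)
            ((2/(1 + (P n t *ᵥ e3) ⬝ᵥ (P (n+1) t *ᵥ e3))) • (P (n+1) t *ᵥ e3)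
              + (2/(1 + (P n t *ᵥ e3) ⬝ᵥ (P (n-1) t *ᵥ e3))) • (P (n-1) t *ᵥ e3)))) t := by
  have hG : ∀ n : ℤ, ∀ t : ℝ, P n t * (P n t)ᵀ = 1 ∧ (P n t).det = 1 ∧
      MDer (P n) (P n t * Amat (α n t) (α (n-1) t)) t := by
    have hQd (n : ℤ) (t : ℝ) : MDer (fun s => Qmat (α n s))
        (Qmat (α n t) * Amat (α (n+1) t) (α n t)
          - Amat (α n t) (α (n-1) t) * Qmat (α n t)) t := by
      obtain ⟨d, hd, he⟩ := hα n t
      exact Q_der hd he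
    have up (n : ℤ) (h : ∀ t : ℝ, P n t * (P n t)ᵀ = 1 ∧ (P n t).det = 1 ∧
        MDer (P n) (P n t * Amat (α n t) (α (n-1) t)) t) :
        ∀ t : ℝ, P (n+1) t * (P (n+1) t)ᵀ = 1 ∧ (P (n+1) t).det = 1 ∧
        MDer (P (n+1)) (P (n+1) t * Amat (α (n+1) t) (α (n+1-1) t)) t := by
      intro t
      obtain ⟨h1, h2, h3⟩ := h t
      refine ⟨?_, ?_, ?_⟩
      · rw [hPrec, Matrix.transpose_mul, mul_assoc, ← mul_assoc (Qmat _), Q_orth, one_mul, h1]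
      · rw [hPrec, Matrix.det_mul, Q_det, h2, one_mul]
      · have h4 := h3.mul (hQd n t)
        have e : P (n+1) = fun s => P n s * Qmat (α n s) := funext (hPrec n)
        rw [add_sub_cancel_right, e]
        convert h4 using 1
        noncomm_ring
    have down (n : ℤ) (h : ∀ t : ℝ, P (n+1) t * (P (n+1) t)ᵀ = 1 ∧ (P (n+1) t).det = 1 ∧
        MDer (P (n+1)) (P (n+1) t * Amat (α (n+1) t) (α (n+1-1) t)) t) :
        ∀ t : ℝ, P n t * (P n t)ᵀ = 1 ∧ (P n t).det = 1 ∧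
        MDer (P n) (P n t * Amat (α n t) (α (n-1) t)) t := by
      intro t
      obtain ⟨h1, h2, h3⟩ := h t
      refine ⟨?_, ?_, ?_⟩
      · rw [hPrec, Matrix.transpose_mul, mul_assoc, ← mul_assoc (Qmat _), Q_orth, one_mul] at h1
        exact h1
      · rwa [hPrec, Matrix.det_mul, Q_det, mul_one] at h2
      · have h4 := h3.mul (hQd n t).transpose
        have e (s : ℝ) : P n s = P (n+1) s * (Qmat (α n s))ᵀ := by
          rw [hPrec, mul_assoc, Q_orth, mul_one]
        rw [add_sub_cancel_right] at h4
        rw [show P n = fun s => P (n+1) s * (Qmat (α n s))ᵀ from funext e]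
        convert h4 using 1
        rw [Matrix.transpose_sub, Matrix.transpose_mul, Matrix.transpose_mul, Amat_transpose,
          Amat_transpose]
        noncomm_ring
    intro n
    induction n using Int.induction_on with
    | zero =>
      have hD (t : ℝ) : MDer (P 0) (P 0 t * Amat (α 0 t) (α (-1) t)) t := hP0diff t
      intro t
      refine ⟨?_, ?_, ?_⟩
      · have key : ∀ i j, (P 0 t * (P 0 t)ᵀ) i j = (P 0 0 * (P 0 0)ᵀ) i j := by
          intro i j
          refine const_of_der (f := fun s => (P 0 s * (P 0 s)ᵀ) i j) (fun s => ?_) t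
          refine ((hD s).mul (hD s).transpose i j).congr_deriv ?_
          rw [Matrix.transpose_mul, Amat_transpose]
          have : P 0 s * Amat (α 0 s) (α (-1) s) * (P 0 s)ᵀ
            + P 0 s * (-Amat (α 0 s) (α (-1) s) * (P 0 s)ᵀ) = 0 := by noncomm_ring
          rw [this]; rfl
        rw [← hO.1, ← hP00]
        ext i j
        exact key i j
      · rw [← hO.2, ← hP00]
        exact const_of_der (f := fun s => (P 0 s).det) (fun s => det_der (hD s)) t
      · exact hD t
    | succ k ih => exact up _ ih
    | pred k ih =>
      apply down
      rw [sub_add_cancel]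
      exact ih
  intro n t
  obtain ⟨h1, h2, h3⟩ := hG n t
  have hm : P (n-1) t = P n t * (Qmat (α (n-1) t))ᵀ := by
    have := hPrec (n-1) t
    rw [sub_add_cancel] at this
    rw [this, mul_assoc, Q_orth, mul_one]
  have pz (z : ℂ) : 0 < 1 + Complex.normSq z := by
    have := Complex.normSq_nonneg z
    linarith
  have eA : 1 + (P n t *ᵥ e3) ⬝ᵥ (P (n+1) t *ᵥ e3) = 2/(1 + Complex.normSq (α n t)) := by
    rw [hPrec, ← Matrix.mulVec_mulVec, dot_mulVec h1]
    have := (pz (α n t)).ne'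
    simp [e3, Qmat, Matrix.mulVec, dotProduct, Fin.sum_univ_three]
    field_simp
    ring
  have eB : 1 + (P n t *ᵥ e3) ⬝ᵥ (P (n-1) t *ᵥ e3) = 2/(1 + Complex.normSq (α (n-1) t)) := by
    rw [hm, ← Matrix.mulVec_mulVec, dot_mulVec h1]
    have := (pz (α (n-1) t)).ne'
    simp [e3, Qmat, Matrix.mulVec, dotProduct, Fin.sum_univ_three]
    field_simp
    ring
  refine ⟨?_, eA, ?_, ?_⟩
  · rw [dot_mulVec h1]
    simp [e3, dotProduct, Fin.sum_univ_three]
  · rw [eA]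
    exact div_pos two_pos (pz _)
  · rw [eA, eB, hPrec, hm, ← Matrix.mulVec_mulVec, ← Matrix.mulVec_mulVec, ← Matrix.mulVec_smul (P n t),
      ← Matrix.mulVec_smul (P n t), ← Matrix.mulVec_add, mulVec_cross h1 h2, ← Matrix.mulVec_neg]
    have hv : -(crossProduct e3 ((2 / (2 / (1 + Complex.normSq (α n t)))) • Qmat (α n t) *ᵥ e3 +
        (2 / (2 / (1 + Complex.normSq (α (n-1) t)))) • (Qmat (α (n-1) t))ᵀ *ᵥ e3))
        = Amat (α n t) (α (n-1) t) *ᵥ e3 := by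
      have p1 := (pz (α n t)).ne'
      have p2 := (pz (α (n-1) t)).ne'
      ext i
      fin_cases i <;>
        simp [e3, Qmat, Amat, cross_apply, Matrix.mulVec, dotProduct, Fin.sum_univ_three] <;>
        field_simp <;> ring
    rw [hv, Matrix.mulVec_mulVec, hasDerivAt_pi]
    intro i
    have h5 := h3 i 2
    simpa [e3, Matrix.mulVec, dotProduct, Fin.sum_univ_three] using h5
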